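/- arXiv:2604.05916 — 2 statements merged into one kernel-verified Lean document; each statement's English description precedes it below -/
import Mathlib

section
/- Let m ≥ 4 and let s, s' be m-dimensional score vectors with s(m−1) < 1 and s'(m−1) < 1, so that s_{−m} and s'_{−m} are score vectors for m−1 alternatives. Suppose there exists a preference profile ≿ on the m−1 alternatives {x_1, …, x_{m−1}} such that x_1 is a Condorcet loser at ≿, f^{s_{−m}}(≿) = {x_1}, and x_1 ∉ f^{s'_{−m}}(≿). Then there exists a preference profile ≿* on the m alternatives {x_1, …, x_m} such that x_1 is a Condorcet loser at ≿*, f^s(≿*) = {x_1}, and x_1 ∉ f^{s'}(≿*). -/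
open Finset

/-- A preference profile over `m` alternatives with `n` voters: voter `i`'s linear
order `≿_i` is encoded by the bijection `P i` sending each alternative to its
0-indexed rank (rank `0` = first, rank `m-1` = last); thus `y ≿_i x` iff
`P i y ≤ P i x`, and the 1-indexed rank is `r(x, ≿_i) = (P i x : ℕ) + 1`. -/
abbrev Profile (m n : ℕ) := Fin n → (Fin m ≃ Fin m)

/-- `s` is a score vector for `m` alternatives: entries in `[0,1]`, weakly
decreasing, first entry `1`, last entry `0` (index `k : Fin m` corresponds to
the 1-indexed rank `k + 1`). -/
def IsScoreVec {m : ℕ} (s : Fin m → ℝ) : Prop :=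
  Antitone s ∧ (∀ k, 0 ≤ s k ∧ s k ≤ 1) ∧
    (∀ k : Fin m, (k : ℕ) = 0 → s k = 1) ∧
    (∀ k : Fin m, (k : ℕ) = m - 1 → s k = 0)

/-- The Borda score vector: 1-indexed, `s^B(k) = (m - k)/(m - 1)`, i.e.
0-indexed, `k ↦ (m - 1 - k)/(m - 1)`. -/
noncomputable def bordaVec (m : ℕ) : Fin m → ℝ :=
  fun k => ((m : ℝ) - 1 - (k : ℕ)) / ((m : ℝ) - 1)

/-- Total score `∑_{i ∈ N} s(r(x, ≿_i))` of alternative `x` at profile `P`. -/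
noncomputable def score {m n : ℕ} (s : Fin m → ℝ) (P : Profile m n) (x : Fin m) : ℝ :=
  ∑ i, s (P i x)

/-- The choice set `f^s(≿)` of the scoring rule with score vector `s`. -/
def winners {m n : ℕ} (s : Fin m → ℝ) (P : Profile m n) : Set (Fin m) :=
  {x | ∀ y, score s P y ≤ score s P x}

/-- `x` is a Condorcet loser at `P`: for every `y ≠ x`,
`|{i : y ≿_i x}| > |{i : x ≿_i y}|`. -/
def CondorcetLoser {m n : ℕ} (P : Profile m n) (x : Fin m) : Prop :=
  ∀ y, y ≠ x →
    (univ.filter fun i => P i x ≤ P i y).card <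
      (univ.filter fun i => P i y ≤ P i x).card

/-- `s₋₁`: remove the first coordinate of `s` and renormalize by `s(2)`
(the all-zero vector if `s(2) = 0`). -/
noncomputable def sMinus1 {m : ℕ} (s : Fin m → ℝ) : Fin (m - 1) → ℝ :=
  fun j =>
    if s ⟨1, by have := j.isLt; omega⟩ = 0 then 0
    else s ⟨(j : ℕ) + 1, by have := j.isLt; omega⟩ / s ⟨1, by have := j.isLt; omega⟩

/-- `s₋ₘ`: remove the last coordinate of `s` and renormalize by `1 - s(m-1)`
(the all-one vector if `s(m-1) = 1`). -/
noncomputable def sMinusM {m : ℕ} (s : Fin m → ℝ) : Fin (m - 1) → ℝ :=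
  fun j =>
    if s ⟨m - 2, by have := j.isLt; omega⟩ = 1 then 1
    else (s ⟨(j : ℕ), by have := j.isLt; omega⟩ - s ⟨m - 2, by have := j.isLt; omega⟩) /
      (1 - s ⟨m - 2, by have := j.isLt; omega⟩)

/-- `s_ave = (1, (1/(m-2)) ∑_{k=2}^{m-1} s(k), 0)` (1-indexed sum bounds). -/
noncomputable def sAve {m : ℕ} (s : Fin m → ℝ) : Fin 3 → ℝ :=
  ![1, (∑ k : Fin m, if 1 ≤ (k : ℕ) ∧ (k : ℕ) ≤ m - 2 then s k else 0) / ((m : ℝ) - 2), 0]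

/-- The score of `x` under `s`, as a function of a single ballot. -/
def ballotScore {m : ℕ} (s : Fin m → ℝ) (x : Fin m) : Equiv.Perm (Fin m) → ℝ :=
  fun σ => s (σ x)

/-- The majority margin of `x` over `y` contributed by a single ballot. -/
def ballotMargin {m : ℕ} (x y : Fin m) : Equiv.Perm (Fin m) → ℝ :=
  fun σ => (if σ x ≤ σ y then 1 else 0) - (if σ y ≤ σ x then 1 else 0)

/-- The drop of `s` between two consecutive ranks. -/
def gap {q : ℕ} (s : Fin (q + 2) → ℝ) (k : Fin (q + 1)) : ℝ :=
  s k.castSucc - s k.succ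

theorem sum_ballotMargin_eq {m n : ℕ} (P : Profile m n) (x y : Fin m) :
    ∑ i, ballotMargin x y (P i) =
      ((univ.filter fun i => P i x ≤ P i y).card : ℝ) -
        (univ.filter fun i => P i y ≤ P i x).card := by
  simp [ballotMargin, Finset.sum_sub_distrib]

theorem condorcetLoser_iff {m n : ℕ} (P : Profile m n) (x : Fin m) :
    CondorcetLoser P x ↔ ∀ y, y ≠ x → 0 < ∑ i, ballotMargin y x (P i) := by
  simp only [CondorcetLoser, sum_ballotMargin_eq, sub_pos, Nat.cast_lt]

theorem winners_eq_singleton_iff {m n : ℕ} (s : Fin m → ℝ) (P : Profile m n) (x : Fin m) :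
    winners s P = {x} ↔ ∀ y, y ≠ x → score s P y < score s P x := by
  constructor
  · intro h y hy
    have hx : x ∈ winners s P := by rw [h]; rfl
    have hy' : y ∉ winners s P := by rw [h]; exact hy
    by_contra hlt
    exact hy' fun z => (hx z).trans (not_lt.mp hlt)
  · intro h
    ext y
    constructor
    · intro hy
      by_contra hne
      exact absurd (hy x) (not_le.mpr (h y hne))
    · rintro rfl z
      by_cases hz : z = y
      · rw [hz]
      · exact (h z hz).le

theorem notMem_winners_iff {m n : ℕ} (s : Fin m → ℝ) (P : Profile m n) (x : Fin m) :
    x ∉ winners s P ↔ ∃ y, score s P x < score s P y := by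
  simp [winners]

/-! ### Swapping neighbours on a ballot -/

theorem exists_perm_apply_eq {α : Type*} [DecidableEq α] {u v a b : α} (huv : u ≠ v)
    (hab : a ≠ b) : ∃ τ : Equiv.Perm α, τ u = a ∧ τ v = b := by
  refine ⟨(Equiv.swap u a).trans (Equiv.swap (Equiv.swap u a v) b), ?_, by simp⟩
  have h : a ≠ Equiv.swap u a v := by
    intro h
    apply huv
    apply (Equiv.swap u a).injective
    rw [← h, Equiv.swap_apply_left]
  simp [Equiv.swap_apply_of_ne_of_ne h hab]

theorem swap_le_swap_iff {q : ℕ} (k : Fin (q + 1)) (i j : Fin (q + 2))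
    (h : ¬(i = k.castSucc ∧ j = k.succ)) (h' : ¬(i = k.succ ∧ j = k.castSucc)) :
    Equiv.swap k.castSucc k.succ i ≤ Equiv.swap k.castSucc k.succ j ↔ i ≤ j := by
  simp only [Equiv.swap_apply_def, Fin.ext_iff, Fin.val_castSucc, Fin.val_succ] at h h' ⊢
  split_ifs <;> simp only [Fin.le_def, Fin.val_castSucc, Fin.val_succ] <;> omega

theorem exists_neighbour_swap {q : ℕ} {u v : Fin (q + 2)} (huv : u ≠ v) (k : Fin (q + 1)) :
    ∃ w : Equiv.Perm (Fin (q + 2)) → ℝ,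
      (∀ s x, w ⬝ᵥ ballotScore s x =
        gap s k * ((if x = v then 1 else 0) - (if x = u then 1 else 0))) ∧
      ∀ x y, w ⬝ᵥ ballotMargin x y =
        2 * ((if x = v ∧ y = u then 1 else 0) - (if x = u ∧ y = v then 1 else 0)) := by
  have hk : k.castSucc ≠ k.succ := (Fin.castSucc_lt_succ).ne
  obtain ⟨τ, hu, hv⟩ := exists_perm_apply_eq huv hk
  refine ⟨Pi.single (τ.trans (Equiv.swap k.castSucc k.succ)) 1 - Pi.single τ 1, ?_, ?_⟩
  · intro s x
    rw [sub_dotProduct, single_dotProduct, single_dotProduct]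
    by_cases hxu : x = u
    · subst hxu
      simp [ballotScore, gap, hu, huv]
    by_cases hxv : x = v
    · subst hxv
      simp [ballotScore, gap, hv, hxu]
    · have h1 : τ x ≠ k.castSucc := fun h => hxu (τ.injective (h.trans hu.symm))
      have h2 : τ x ≠ k.succ := fun h => hxv (τ.injective (h.trans hv.symm))
      simp [ballotScore, hxu, hxv, Equiv.swap_apply_of_ne_of_ne h1 h2]
  · intro x y
    rw [sub_dotProduct, single_dotProduct, single_dotProduct]
    have hlt : ¬ k.succ ≤ k.castSucc := not_le.mpr Fin.castSucc_lt_succ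
    have hle : k.castSucc ≤ k.succ := Fin.castSucc_lt_succ.le
    have eu : ∀ z, τ z = k.castSucc ↔ z = u := fun z => by rw [← hu, τ.apply_eq_iff_eq]
    have ev : ∀ z, τ z = k.succ ↔ z = v := fun z => by rw [← hv, τ.apply_eq_iff_eq]
    by_cases h1 : x = u ∧ y = v
    · obtain ⟨rfl, rfl⟩ := h1
      simp only [ballotMargin, Equiv.trans_apply, hu, hv, Equiv.swap_apply_left,
        Equiv.swap_apply_right, hlt, hle, huv, huv.symm]
      norm_num
    by_cases h2 : x = v ∧ y = u
    · obtain ⟨rfl, rfl⟩ := h2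
      simp only [ballotMargin, Equiv.trans_apply, hu, hv, Equiv.swap_apply_left,
        Equiv.swap_apply_right, hlt, hle, huv, huv.symm]
      norm_num
    · have e1 := swap_le_swap_iff k (τ x) (τ y) (by rwa [eu, ev]) (by rwa [eu, ev])
      have e2 := swap_le_swap_iff k (τ y) (τ x) (by rw [eu, ev]; tauto) (by rw [eu, ev]; tauto)
      simp [ballotMargin, h1, h2, e1, e2]

/-- Combining swaps of `u` and `v` at all ranks, with signed weights `c`. -/
theorem exists_combined_swap {q : ℕ} {u v : Fin (q + 2)} (huv : u ≠ v) (c : Fin (q + 1) → ℝ) :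
    ∃ w : Equiv.Perm (Fin (q + 2)) → ℝ,
      (∀ s x, w ⬝ᵥ ballotScore s x =
        (c ⬝ᵥ gap s) * ((if x = v then 1 else 0) - (if x = u then 1 else 0))) ∧
      ∀ x y, w ⬝ᵥ ballotMargin x y =
        (∑ k, c k) * 2 *
          ((if x = v ∧ y = u then 1 else 0) - (if x = u ∧ y = v then 1 else 0)) := by
  choose W hs hm using fun k => exists_neighbour_swap huv k
  refine ⟨∑ k, c k • W k, fun s x => ?_, fun x y => ?_⟩
  · simp only [sum_dotProduct, smul_dotProduct, hs, smul_eq_mul, ← mul_assoc, ← Finset.sum_mul]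
    rfl
  · simp only [sum_dotProduct, smul_dotProduct, hm, smul_eq_mul, ← mul_assoc, ← Finset.sum_mul]

theorem exists_sum_eq_one_dotProduct_eq_neg_one {ι : Type*} [Fintype ι] [DecidableEq ι]
    {a : ι → ℝ} {i j : ι} (h : a i ≠ a j) : ∃ c : ι → ℝ, ∑ k, c k = 1 ∧ c ⬝ᵥ a = -1 := by
  have h' : a i - a j ≠ 0 := sub_ne_zero.mpr h
  refine ⟨Pi.single i ((-1 - a j) / (a i - a j)) + Pi.single j (1 - (-1 - a j) / (a i - a j)),
    ?_, ?_⟩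
  · simp [Finset.sum_add_distrib]
  · rw [add_dotProduct, single_dotProduct, single_dotProduct]
    field_simp
    ring

theorem exists_dotProduct_eq_zero_dotProduct_eq_one {ι : Type*} [Fintype ι] [DecidableEq ι]
    {a b : ι → ℝ} (ha : ∑ k, a k = 1) (hb : ∑ k, b k = 1) (h : a ≠ b) :
    ∃ c : ι → ℝ, c ⬝ᵥ a = 0 ∧ c ⬝ᵥ b = 1 := by
  have hij : ∃ i j, a j * b i - a i * b j ≠ 0 := by
    by_contra! H
    apply h
    ext i
    have : ∑ j, (a j * b i - a i * b j) = 0 := Finset.sum_eq_zero fun j _ => H i j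
    rw [Finset.sum_sub_distrib, ← Finset.sum_mul, ← Finset.mul_sum, ha, hb] at this
    linarith
  obtain ⟨i, j, hij⟩ := hij
  refine ⟨(a j * b i - a i * b j)⁻¹ • (Pi.single i (a j) - Pi.single j (a i)), ?_, ?_⟩ <;>
    rw [smul_dotProduct, sub_dotProduct, single_dotProduct, single_dotProduct, smul_eq_mul]
  · ring
  · exact inv_mul_cancel₀ hij

/-- Real ballot weights at which `x` is a Condorcet loser, is the unique winner for `s`, and does
not win for `s'`. -/
def Separates {m : ℕ} (s s' : Fin m → ℝ) (x : Fin m) (w : Equiv.Perm (Fin m) → ℝ) : Prop :=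
  (∀ y, y ≠ x → 0 < w ⬝ᵥ ballotMargin y x) ∧
    (∀ y, y ≠ x → w ⬝ᵥ ballotScore s y < w ⬝ᵥ ballotScore s x) ∧
    ∃ y, w ⬝ᵥ ballotScore s' x < w ⬝ᵥ ballotScore s' y

theorem exists_separates {q : ℕ} {s s' : Fin (q + 2) → ℝ} {x y z : Fin (q + 2)}
    (hxy : x ≠ y) (hxz : x ≠ z) (hyz : y ≠ z) (hs : ∑ k, gap s k = 1) (hs' : ∑ k, gap s' k = 1)
    {i j : Fin (q + 1)} (hij : gap s i ≠ gap s j) (hne : gap s ≠ gap s') :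
    ∃ w, Separates s s' x w := by
  obtain ⟨c, hc1, hcs⟩ := exists_sum_eq_one_dotProduct_eq_neg_one hij
  obtain ⟨d, hds, hds'⟩ := exists_dotProduct_eq_zero_dotProduct_eq_one hs hs' hne
  have hW : ∀ v, ∃ w : Equiv.Perm (Fin (q + 2)) → ℝ, x ≠ v →
      (∀ y, w ⬝ᵥ ballotScore s y = -1 * ((if y = v then 1 else 0) - (if y = x then 1 else 0))) ∧
      ∀ y, y ≠ x → w ⬝ᵥ ballotMargin y x = 2 * (if y = v then 1 else 0) := by
    intro v
    by_cases hv : x = v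
    · exact ⟨0, fun h => absurd hv h⟩
    obtain ⟨w, h1, h2⟩ := exists_combined_swap hv c
    refine ⟨w, fun _ => ⟨fun y => by rw [h1, hcs], fun y hy => ?_⟩⟩
    rw [h2, hc1]
    simp [hy]
  choose W hW using hW
  obtain ⟨w₂, h2s, h2m⟩ := exists_combined_swap hyz.symm d
  set w₁ := ∑ v ∈ univ.erase x, W v with hw₁
  have h1m : ∀ y, y ≠ x → w₁ ⬝ᵥ ballotMargin y x = 2 := by
    intro y hy
    rw [hw₁, sum_dotProduct, Finset.sum_congr rfl fun v hv =>
      (hW v (Finset.ne_of_mem_erase hv).symm).2 y hy]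
    simp [hy]
  have h1s : ∀ y, y ≠ x → w₁ ⬝ᵥ ballotScore s y = -1 := by
    intro y hy
    rw [hw₁, sum_dotProduct, Finset.sum_congr rfl fun v hv =>
      (hW v (Finset.ne_of_mem_erase hv).symm).1 y]
    simp [hy]
  have h1x : 0 ≤ w₁ ⬝ᵥ ballotScore s x := by
    rw [hw₁, sum_dotProduct, Finset.sum_congr rfl fun v hv =>
      (hW v (Finset.ne_of_mem_erase hv).symm).1 x]
    refine Finset.sum_nonneg fun v hv => ?_
    simp [(Finset.ne_of_mem_erase hv).symm]
  refine ⟨w₁ + (w₁ ⬝ᵥ ballotScore s' x - w₁ ⬝ᵥ ballotScore s' y + 1) • w₂, ?_, ?_, y, ?_⟩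
  · intro v hv
    rw [add_dotProduct, smul_dotProduct, h1m v hv, h2m]
    simp [hxy, hxz]
  · intro v hv
    rw [add_dotProduct, add_dotProduct, smul_dotProduct, smul_dotProduct, h1s v hv, h2s, h2s, hds]
    simp only [zero_mul, smul_zero, add_zero]
    linarith
  · rw [add_dotProduct, add_dotProduct, smul_dotProduct, smul_dotProduct, h2s, h2s, hds']
    simp only [hxy, hxz, hyz, if_true, if_false, smul_eq_mul]
    linarith

/-! ### From real weights to profiles -/

theorem isOpen_setOf_separates {m : ℕ} (s s' : Fin m → ℝ) (x : Fin m) :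
    IsOpen {w | Separates s s' x w} := by
  have hc : ∀ F : Equiv.Perm (Fin m) → ℝ, Continuous fun w : Equiv.Perm (Fin m) → ℝ => w ⬝ᵥ F :=
    fun F => by unfold dotProduct; fun_prop
  simp only [Separates, Set.ofPred_and, Set.ofPred_forall, Set.ofPred_exists]
  refine .inter ?_ (.inter ?_ ?_)
  · exact isOpen_iInter_of_finite fun y => isOpen_iInter_of_finite fun _ =>
      isOpen_lt continuous_const (hc _)
  · exact isOpen_iInter_of_finite fun y => isOpen_iInter_of_finite fun _ => isOpen_lt (hc _) (hc _)
  · exact isOpen_iUnion fun y => isOpen_lt (hc _) (hc _)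

theorem Separates.smul {m : ℕ} {s s' : Fin m → ℝ} {x : Fin m} {w : Equiv.Perm (Fin m) → ℝ}
    (h : Separates s s' x w) {t : ℝ} (ht : 0 < t) : Separates s s' x (t • w) := by
  simpa only [Separates, smul_dotProduct, smul_eq_mul, mul_pos_iff_of_pos_left ht,
    mul_lt_mul_iff_right₀ ht] using h

theorem sum_ballotScore_eq {m : ℕ} (s : Fin m → ℝ) (x y : Fin m) :
    ∑ σ, ballotScore s x σ = ∑ σ, ballotScore s y σ := by
  rw [← Equiv.sum_comp (Equiv.mulRight (Equiv.swap x y))]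
  simp [ballotScore]

theorem sum_ballotMargin_perm_eq_zero {m : ℕ} (x y : Fin m) :
    ∑ σ, ballotMargin x y σ = 0 := by
  have h := Equiv.sum_comp (Equiv.mulRight (Equiv.swap x y)) (ballotMargin x y)
  have h' : ∀ σ, ballotMargin x y (Equiv.mulRight (Equiv.swap x y) σ) = -ballotMargin x y σ := by
    intro σ
    simp [ballotMargin]
  simp only [h', Finset.sum_neg_distrib] at h
  linarith

theorem Separates.add_const {m : ℕ} {s s' : Fin m → ℝ} {x : Fin m}
    {w : Equiv.Perm (Fin m) → ℝ} (h : Separates s s' x w) (t : ℝ) :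
    Separates s s' x (w + fun _ => t) := by
  have hF : ∀ F : Equiv.Perm (Fin m) → ℝ, (fun _ => t) ⬝ᵥ F = t * ∑ σ, F σ := fun F => by
    simp [dotProduct, Finset.mul_sum]
  obtain ⟨h1, h2, y, h3⟩ := h
  refine ⟨fun v hv => ?_, fun v hv => ?_, y, ?_⟩
  · rw [add_dotProduct, hF, sum_ballotMargin_perm_eq_zero]
    simpa using h1 v hv
  · rw [add_dotProduct, add_dotProduct, hF, hF, sum_ballotScore_eq s v x]
    simpa using h2 v hv
  · rw [add_dotProduct, add_dotProduct, hF, hF, sum_ballotScore_eq s' y x]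
    simpa using h3

theorem exists_nat_mul_eq_intCast {ι : Type*} [Fintype ι] (r : ι → ℚ) :
    ∃ d : ℕ, 0 < d ∧ ∀ i, ∃ z : ℤ, (d : ℚ) * r i = z := by
  classical
  refine ⟨∏ i, (r i).den, Finset.prod_pos fun i _ => (r i).pos, fun i => ?_⟩
  rw [← Finset.prod_erase_mul _ _ (Finset.mem_univ i)]
  refine ⟨(∏ k ∈ univ.erase i, ((r k).den : ℤ)) * (r i).num, ?_⟩
  push_cast
  rw [mul_assoc, Rat.den_mul_eq_num]

theorem Separates.exists_nat {m : ℕ} {s s' : Fin m → ℝ} {x : Fin m}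
    {w : Equiv.Perm (Fin m) → ℝ} (h : Separates s s' x w) :
    ∃ k : Equiv.Perm (Fin m) → ℕ, Separates s s' x fun σ => (k σ : ℝ) := by
  have hd : DenseRange (Pi.map fun (_ : Equiv.Perm (Fin m)) (r : ℚ) => (r : ℝ)) :=
    DenseRange.piMap fun _ => Rat.denseRange_cast
  obtain ⟨r, hr⟩ := hd.exists_mem_open (isOpen_setOf_separates s s' x) ⟨w, h⟩
  obtain ⟨d, hd0, hd⟩ := exists_nat_mul_eq_intCast r
  choose z hz using hd
  have hz' : Separates s s' x fun σ => (z σ : ℝ) := by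
    convert Separates.smul hr (Nat.cast_pos.mpr hd0) using 1
    ext σ
    simp only [Pi.smul_apply, Pi.map_apply, smul_eq_mul]
    exact_mod_cast (hz σ).symm
  refine ⟨fun σ => (z σ + ∑ τ, |z τ|).toNat, ?_⟩
  convert hz'.add_const ((∑ τ, |z τ| : ℤ) : ℝ) using 1
  ext σ
  have hnn : 0 ≤ z σ + ∑ τ, |z τ| := by
    have := Finset.single_le_sum (f := fun τ => |z τ|) (fun τ _ => abs_nonneg _)
      (Finset.mem_univ σ)
    have := neg_abs_le (z σ)
    linarith
  rw [Pi.add_apply, ← Int.cast_natCast, Int.toNat_of_nonneg hnn]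
  push_cast
  rfl

theorem exists_profile_sum_eq {m : ℕ} (k : Equiv.Perm (Fin m) → ℕ) :
    ∃ (n : ℕ) (P : Profile m n),
      ∀ F : Equiv.Perm (Fin m) → ℝ, ∑ i, F (P i) = (fun σ => (k σ : ℝ)) ⬝ᵥ F := by
  let e := (Fintype.equivFin (Σ σ, Fin (k σ))).symm
  refine ⟨_, fun i => (e i).1, fun F => ?_⟩
  rw [Equiv.sum_comp e fun p => F p.1, Fintype.sum_sigma]
  simp [dotProduct]

theorem Separates.exists_profile {m : ℕ} {s s' : Fin m → ℝ} {x : Fin m}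
    {w : Equiv.Perm (Fin m) → ℝ} (h : Separates s s' x w) :
    ∃ n : ℕ, 0 < n ∧ ∃ P : Profile m n,
      CondorcetLoser P x ∧ winners s P = {x} ∧ x ∉ winners s' P := by
  obtain ⟨k, h1, h2, y, h3⟩ := h.exists_nat
  obtain ⟨n, P, hP⟩ := exists_profile_sum_eq k
  simp only [← hP] at h1 h2 h3
  refine ⟨n, ?_, P, (condorcetLoser_iff P x).mpr h1, (winners_eq_singleton_iff s P x).mpr h2,
    (notMem_winners_iff s' P x).mpr ⟨y, h3⟩⟩
  rcases Nat.eq_zero_or_pos n with rfl | hn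
  · simp at h3
  · exact hn

/-! ### Score vectors with constant gaps -/

theorem sum_ballotMargin_left {m : ℕ} (x : Fin m) (σ : Equiv.Perm (Fin m)) :
    ∑ y, ballotMargin y x σ = 2 * ((σ x : ℕ) : ℝ) + 1 - m := by
  simp only [ballotMargin, Finset.sum_sub_distrib]
  rw [Equiv.sum_comp σ fun j => if j ≤ σ x then (1 : ℝ) else 0,
    Equiv.sum_comp σ fun j => if σ x ≤ j then (1 : ℝ) else 0, Finset.sum_boole, Finset.sum_boole,
    Finset.filter_ge_eq_Iic, Finset.filter_le_eq_Ici, Fin.card_Iic, Fin.card_Ici,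
    Nat.cast_sub (σ x).isLt.le]
  push_cast
  ring

theorem sum_range_natCast (m : ℕ) : ∑ j ∈ range m, (j : ℝ) = m * (m - 1) / 2 := by
  induction m with
  | zero => simp
  | succ m ih =>
    rw [Finset.sum_range_succ, ih]
    push_cast
    ring

theorem not_condorcetLoser_of_affine {m n : ℕ} (hm : 2 ≤ m) {s : Fin m → ℝ} {α β : ℝ} (hβ : 0 < β)
    (hs : ∀ k : Fin m, s k = α - β * (k : ℕ)) {P : Profile m n} {x : Fin m}
    (hx : x ∈ winners s P) : ¬ CondorcetLoser P x := by
  intro hC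
  rw [condorcetLoser_iff] at hC
  have hself : ∀ σ, ballotMargin x x σ = 0 := fun σ => by simp [ballotMargin]
  obtain ⟨y, hy⟩ : ∃ y : Fin m, y ≠ x := by
    have : Nontrivial (Fin m) := Fin.nontrivial_iff_two_le.mpr hm
    exact exists_ne x
  have hpos : 0 < ∑ y, ∑ i, ballotMargin y x (P i) := by
    refine Finset.sum_pos' (fun v _ => ?_) ⟨y, Finset.mem_univ y, hC y hy⟩
    by_cases hv : v = x
    · simp [hv, hself]
    · exact (hC v hv).le
  rw [Finset.sum_comm] at hpos
  simp only [sum_ballotMargin_left] at hpos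
  have hsum : ∀ v, score s P v = n * α - β * ∑ i, ((P i v : ℕ) : ℝ) := fun v => by
    simp [score, hs, Finset.sum_sub_distrib, Finset.mul_sum]
  have hrank : ∑ v, ∑ i, ((P i v : ℕ) : ℝ) = n * (m * (m - 1) / 2) := by
    rw [Finset.sum_comm]
    have : ∀ i, ∑ v, ((P i v : ℕ) : ℝ) = m * (m - 1) / 2 := fun i => by
      rw [Equiv.sum_comp (P i) fun j => ((j : ℕ) : ℝ), Fin.sum_univ_eq_sum_range (fun j => (j : ℝ)),
        sum_range_natCast]
    simp [this]
  have hle : ∑ _v : Fin m, ∑ i, ((P i x : ℕ) : ℝ) ≤ ∑ v, ∑ i, ((P i v : ℕ) : ℝ) := by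
    refine Finset.sum_le_sum fun v _ => ?_
    have := hx v
    rw [hsum, hsum] at this
    exact le_of_mul_le_mul_left (by linarith) hβ
  rw [hrank] at hle
  simp only [Finset.sum_sub_distrib, Finset.sum_add_distrib, ← Finset.mul_sum, Finset.sum_const,
    Finset.card_univ, Fintype.card_fin, nsmul_eq_mul] at hpos hle
  have hm0 : (0 : ℝ) < m := by exact_mod_cast (by omega : 0 < m)
  nlinarith

theorem sum_gap {q : ℕ} (s : Fin (q + 2) → ℝ) : ∑ k, gap s k = s 0 - s (Fin.last _) := by
  have h1 := Fin.sum_univ_castSucc s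
  have h2 := Fin.sum_univ_succ s
  simp only [gap, Finset.sum_sub_distrib]
  linarith

theorem eq_of_gap_eq {q : ℕ} {s s' : Fin (q + 2) → ℝ} (h0 : s 0 = s' 0) (h : gap s = gap s') :
    s = s' := by
  ext k
  induction k using Fin.induction with
  | zero => exact h0
  | succ k ih =>
    have := congrFun h k
    simp only [gap] at this
    linarith

theorem eq_affine_of_gap_const {q : ℕ} {s : Fin (q + 2) → ℝ} {d : ℝ} (h : ∀ k, gap s k = d)
    (k : Fin (q + 2)) : s k = s 0 - d * (k : ℕ) := by
  induction k using Fin.induction with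
  | zero => simp
  | succ k ih =>
    have := h k
    simp only [gap] at this
    simp only [Fin.val_castSucc] at ih
    simp only [Fin.val_succ]
    push_cast
    linarith

/-- Lifting a separating profile for `s₋ₘ, s'₋ₘ` on `m - 1` alternatives to one
for `s, s'` on `m` alternatives. -/
theorem lift_sMinusM_profile
    (m : ℕ) (hm : 4 ≤ m) (s s' : Fin m → ℝ)
    (hs : IsScoreVec s) (hs' : IsScoreVec s')
    (h1 : s ⟨m - 2, by omega⟩ < 1) (h2 : s' ⟨m - 2, by omega⟩ < 1)
    (hprev : ∃ n : ℕ, 0 < n ∧ ∃ P : Profile (m - 1) n,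
      CondorcetLoser P ⟨0, by omega⟩ ∧
      winners (sMinusM s) P = {(⟨0, by omega⟩ : Fin (m - 1))} ∧
      (⟨0, by omega⟩ : Fin (m - 1)) ∉ winners (sMinusM s') P) :
    ∃ n : ℕ, 0 < n ∧ ∃ P : Profile m n,
      CondorcetLoser P ⟨0, by omega⟩ ∧
      winners s P = {(⟨0, by omega⟩ : Fin m)} ∧
      (⟨0, by omega⟩ : Fin m) ∉ winners s' P := by
  obtain ⟨q, rfl⟩ : ∃ q, m = q + 2 := ⟨m - 2, by omega⟩
  obtain ⟨n, -, P, hC, hw, hw'⟩ := hprev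
  have hmem : (⟨0, by omega⟩ : Fin (q + 2 - 1)) ∈ winners (sMinusM s) P := by rw [hw]; rfl
  have hfirst : s 0 = 1 := hs.2.2.1 0 rfl
  have hfirst' : s' 0 = 1 := hs'.2.2.1 0 rfl
  have hlast : s (Fin.last _) = 0 := hs.2.2.2 _ (by simp)
  have hlast' : s' (Fin.last _) = 0 := hs'.2.2.2 _ (by simp)
  have hsum : ∑ k, gap s k = 1 := by rw [sum_gap, hfirst, hlast, sub_zero]
  have hsum' : ∑ k, gap s' k = 1 := by rw [sum_gap, hfirst', hlast', sub_zero]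
  have hne : gap s ≠ gap s' := by
    intro h
    rw [eq_of_gap_eq (hfirst.trans hfirst'.symm) h] at hmem
    exact hw' hmem
  obtain ⟨i, hi⟩ : ∃ i, gap s i ≠ gap s 0 := by
    by_contra! H
    have haff := eq_affine_of_gap_const H
    have hd : 0 < gap s 0 := by
      have := haff (Fin.last _)
      rw [hlast, hfirst] at this
      by_contra hd
      nlinarith [Nat.cast_nonneg (α := ℝ) ((Fin.last (q + 1) : Fin (q + 2)) : ℕ)]
    have ht : 0 < 1 - s ⟨q + 2 - 2, by omega⟩ := sub_pos.mpr h1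
    refine not_condorcetLoser_of_affine (α := (1 - s ⟨q + 2 - 2, by omega⟩) /
      (1 - s ⟨q + 2 - 2, by omega⟩)) (β := gap s 0 / (1 - s ⟨q + 2 - 2, by omega⟩)) (by omega)
      (div_pos hd ht) (fun k => ?_) hmem hC
    rw [sMinusM, if_neg h1.ne, haff ⟨(k : ℕ), _⟩, hfirst]
    ring
  obtain ⟨w, hw⟩ := exists_separates (x := (⟨0, by omega⟩ : Fin (q + 2))) (y := ⟨1, by omega⟩)
    (z := ⟨2, by omega⟩) (by simp) (by simp) (by simp) hsum hsum' hi hne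
  exact hw.exists_profile
end

section
/- Let m ≥ 4 and let s, s' be m-dimensional score vectors. Suppose there exists a preference profile ≿ on three alternatives {x, y, z} such that x is a Condorcet loser at ≿, f^{s_ave}(≿) = {x}, and x ∉ f^{s'_ave}(≿). Then there exists a preference profile ≿* on the m alternatives {x_1, …, x_m} such that x_1 is a Condorcet loser at ≿*, f^s(≿*) = {x_1}, and x_1 ∉ f^{s'}(≿*). -/
open Finset

/-- The permutations of `α` that fix both `z` and `l`. -/
def fixingPerms {α : Type*} [Fintype α] [DecidableEq α] (z l : α) : Finset (Equiv.Perm α) :=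
  univ.filter fun g => g z = z ∧ g l = l

section FixingPerms

variable {α : Type*} [Fintype α] [DecidableEq α] {z l : α}

lemma mem_fixingPerms {g : Equiv.Perm α} : g ∈ fixingPerms z l ↔ g z = z ∧ g l = l := by
  simp [fixingPerms]

lemma fixingPerms_card_pos (z l : α) : 0 < (fixingPerms z l).card :=
  Finset.card_pos.2 ⟨1, by simp [mem_fixingPerms]⟩

lemma mul_swap_mem_fixingPerms {k k' : α} (hkz : k ≠ z) (hkl : k ≠ l) (hkz' : k' ≠ z)
    (hkl' : k' ≠ l) {g : Equiv.Perm α} (hg : g ∈ fixingPerms z l) :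
    g * Equiv.swap k k' ∈ fixingPerms z l := by
  rw [mem_fixingPerms] at *
  simp [Equiv.swap_apply_of_ne_of_ne hkz.symm hkz'.symm,
    Equiv.swap_apply_of_ne_of_ne hkl.symm hkl'.symm, hg]

lemma sum_fixingPerms_mul_swap {k k' : α} (hkz : k ≠ z) (hkl : k ≠ l) (hkz' : k' ≠ z)
    (hkl' : k' ≠ l) (G : Equiv.Perm α → ℝ) :
    ∑ g ∈ fixingPerms z l, G (g * Equiv.swap k k') = ∑ g ∈ fixingPerms z l, G g :=
  Finset.sum_nbij' (· * Equiv.swap k k') (· * Equiv.swap k k')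
    (fun _ hg => mul_swap_mem_fixingPerms hkz hkl hkz' hkl' hg)
    (fun _ hg => mul_swap_mem_fixingPerms hkz hkl hkz' hkl' hg)
    (fun g _ => by simp [mul_assoc]) (fun g _ => by simp [mul_assoc]) (fun _ _ => rfl)

/-- Averaging over permutations fixing `z` and `l` averages over the remaining points. -/
lemma sum_fixingPerms_apply (s : α → ℝ) {k : α} (hkz : k ≠ z) (hkl : k ≠ l) :
    ((univ.filter fun j => j ≠ z ∧ j ≠ l).card : ℝ) * ∑ g ∈ fixingPerms z l, s (g k) =
      (fixingPerms z l).card * ∑ j ∈ univ.filter (fun j => j ≠ z ∧ j ≠ l), s j := by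
  have h1 : ∀ j ∈ univ.filter (fun j => j ≠ z ∧ j ≠ l),
      ∑ g ∈ fixingPerms z l, s (g j) = ∑ g ∈ fixingPerms z l, s (g k) := by
    intro j hj
    simp only [mem_filter, mem_univ, true_and] at hj
    rw [← sum_fixingPerms_mul_swap hkz hkl hj.1 hj.2]
    simp
  rw [← nsmul_eq_mul, ← Finset.sum_const, ← Finset.sum_congr rfl h1, Finset.sum_comm,
    ← nsmul_eq_mul, ← Finset.sum_const]
  refine Finset.sum_congr rfl fun g hg => ?_
  rw [mem_fixingPerms] at hg
  refine Finset.sum_equiv g (fun j => ?_) (fun _ _ => rfl)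
  have e1 : g j = z ↔ j = z := by rw [← g.injective.eq_iff (a := j), hg.1]
  have e2 : g j = l ↔ j = l := by rw [← g.injective.eq_iff (a := j), hg.2]
  simp [e1, e2]

end FixingPerms

/-- The average of the intermediate scores, i.e. the middle entry of `sAve s`. -/
noncomputable def midScore {m : ℕ} (s : Fin m → ℝ) : ℝ :=
  (∑ k : Fin m, if 1 ≤ (k : ℕ) ∧ (k : ℕ) ≤ m - 2 then s k else 0) / ((m : ℝ) - 2)

/-- Averaged score of the point `k` over all rankings fixing the top rank `z` and the
bottom rank `l`. -/
lemma sum_fixingPerms_score {m : ℕ} (hm : 4 ≤ m) {s : Fin m → ℝ} (hs : IsScoreVec s)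
    {z l : Fin m} (hz : (z : ℕ) = 0) (hl : (l : ℕ) = m - 1) (k : Fin m) :
    ∑ g ∈ fixingPerms z l, s (g k) = (fixingPerms z l).card *
      ((if k = z then 1 else 0) + midScore s *
        (1 - (if k = z then 1 else 0) - (if k = l then 1 else 0))) := by
  obtain ⟨-, -, h0, h1⟩ := hs
  have hzl : z ≠ l := by intro h; rw [h] at hz; omega
  by_cases hkz : k = z
  · subst hkz
    rw [Finset.sum_congr rfl (g := fun _ => (1 : ℝ))]
    · simp [hzl]
    · intro g hg
      rw [(mem_fixingPerms.1 hg).1, h0 _ hz]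
  by_cases hkl : k = l
  · subst hkl
    rw [Finset.sum_congr rfl (g := fun _ => (0 : ℝ))]
    · simp [hkz]
    · intro g hg
      rw [(mem_fixingPerms.1 hg).2, h1 _ hl]
  have key := sum_fixingPerms_apply s hkz hkl
  have hf : (univ.filter fun j => j ≠ z ∧ j ≠ l) =
      univ.filter fun j : Fin m => 1 ≤ (j : ℕ) ∧ (j : ℕ) ≤ m - 2 := by
    ext j
    simp only [mem_filter, mem_univ, true_and, ne_eq, Fin.ext_iff]
    omega
  have hc : ((univ.filter fun j => j ≠ z ∧ j ≠ l).card : ℝ) = (m : ℝ) - 2 := by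
    have : (univ.filter fun j => j ≠ z ∧ j ≠ l) = (univ.erase l).erase z := by
      ext j; simp
    rw [this, card_erase_of_mem (by simp [hzl]), card_erase_of_mem (by simp), card_univ,
      Fintype.card_fin, Nat.cast_sub (by omega), Nat.cast_sub (by omega)]
    push_cast; ring
  rw [hc, hf, Finset.sum_filter] at key
  have hm' : (m : ℝ) - 2 ≠ 0 := by
    have : (4 : ℝ) ≤ m := by exact_mod_cast hm
    linarith
  simp only [hkz, hkl, if_false, midScore]
  field_simp
  linarith

/-- For ranks `a` and `b`: `1` if `b` is the better one, `-1` if `a` is, and `0` if they agree. -/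
noncomputable def rankSign {m : ℕ} (a b : Fin m) : ℝ :=
  (if b ≤ a then 1 else 0) - (if a ≤ b then 1 else 0)

lemma rankSign_of_lt {m : ℕ} {a b : Fin m} (h : b < a) : rankSign a b = 1 := by
  simp [rankSign, h.le, h.not_ge]

lemma rankSign_of_gt {m : ℕ} {a b : Fin m} (h : a < b) : rankSign a b = -1 := by
  simp [rankSign, h.le, h.not_ge]

lemma sum_fixingPerms_rankSign {m : ℕ} (hm : 4 ≤ m)
    {z l : Fin m} (hz : (z : ℕ) = 0) (hl : (l : ℕ) = m - 1) {a b : Fin m} (hab : a ≠ b) :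
    ∑ g ∈ fixingPerms z l, rankSign (g a) (g b) = (fixingPerms z l).card *
      ((if b = z then 1 else 0) + (if a = l then 1 else 0) +
          (if a = z then if b = l then 1 else 0 else 0)
        - (if a = z then 1 else 0) - (if b = l then 1 else 0) -
          (if b = z then if a = l then 1 else 0 else 0)) := by
  have hzl : z ≠ l := by intro h; rw [h] at hz; omega
  have hlz := hzl.symm
  have hpos : ∀ j, j ≠ z → z < j := fun j hj => by
    rw [Fin.lt_def]; rw [ne_eq, Fin.ext_iff] at hj; omega
  have hlt : ∀ j, j ≠ l → j < l := fun j hj => by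
    rw [Fin.lt_def]; rw [ne_eq, Fin.ext_iff] at hj; omega
  have const : ∀ v : ℝ, (∀ g ∈ fixingPerms z l, rankSign (g a) (g b) = v) →
      ∑ g ∈ fixingPerms z l, rankSign (g a) (g b) = (fixingPerms z l).card * v := by
    intro v h
    rw [Finset.sum_congr rfl h, Finset.sum_const, nsmul_eq_mul]
  by_cases haz : a = z
  · subst haz
    rw [const (-1)]
    · by_cases hbl : b = l <;> simp [hbl, hab.symm, hzl, hlz]
    · intro g hg
      refine rankSign_of_gt ?_
      rw [(mem_fixingPerms.1 hg).1]
      exact hpos _ fun h => hab (g.injective (by rw [h, (mem_fixingPerms.1 hg).1]))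
  by_cases hbz : b = z
  · subst hbz
    rw [const 1]
    · by_cases hal : a = l <;> simp [hal, hab, hzl, hlz]
    · intro g hg
      refine rankSign_of_lt ?_
      rw [(mem_fixingPerms.1 hg).1]
      exact hpos _ fun h => hab (g.injective (by rw [h, (mem_fixingPerms.1 hg).1]))
  by_cases hal : a = l
  · subst hal
    rw [const 1]
    · simp [haz, hbz, hab.symm]
    · intro g hg
      refine rankSign_of_lt ?_
      rw [(mem_fixingPerms.1 hg).2]
      exact hlt _ fun h => hab (g.injective (by rw [h, (mem_fixingPerms.1 hg).2]))
  by_cases hbl : b = l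
  · subst hbl
    rw [const (-1)]
    · simp [haz, hbz, hab]
    · intro g hg
      refine rankSign_of_gt ?_
      rw [(mem_fixingPerms.1 hg).2]
      exact hlt _ fun h => hab (g.injective (by rw [h, (mem_fixingPerms.1 hg).2]))
  have h := sum_fixingPerms_mul_swap haz hal hbz hbl (fun g => rankSign (g a) (g b))
  have h2 : ∀ g : Equiv.Perm (Fin m), rankSign (g b) (g a) = -rankSign (g a) (g b) := by
    intro g; simp [rankSign]
  simp only [Equiv.Perm.mul_apply, Equiv.swap_apply_left, Equiv.swap_apply_right, h2,
    Finset.sum_neg_distrib] at h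
  simp only [haz, hbz, hal, hbl, if_false]
  linarith

lemma exists_equiv_top_bottom {α : Type*} [DecidableEq α] {z l t u : α} (hzl : z ≠ l)
    (htu : t ≠ u) : ∃ e : α ≃ α, e t = z ∧ e u = l := by
  refine ⟨(Equiv.swap t z).trans (Equiv.swap (Equiv.swap t z u) l), ?_, by simp⟩
  have h : z ≠ Equiv.swap t z u := fun h =>
    htu ((Equiv.swap t z).injective (by rw [← h, Equiv.swap_apply_left]))
  simp [Equiv.swap_apply_of_ne_of_ne h hzl]

/-- The profile consisting of `c t u` copies of the rankings `(e t u).trans g`, `g ∈ H`. -/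
lemma exists_profile_sum {m : ℕ} (c : Fin m → Fin m → ℕ)
    (e : Fin m → Fin m → (Fin m ≃ Fin m)) (H : Finset (Equiv.Perm (Fin m))) :
    ∃ (n : ℕ) (P : Profile m n), ∀ G : (Fin m ≃ Fin m) → ℝ,
      ∑ i, G (P i) = ∑ t, ∑ u, (c t u : ℝ) * ∑ g ∈ H, G ((e t u).trans g) := by
  let V := (Σ p : Fin m × Fin m, Fin (c p.1 p.2)) × H
  let Q : V → (Fin m ≃ Fin m) := fun v => (e v.1.1.1 v.1.1.2).trans v.2.1
  refine ⟨Fintype.card V, fun i => Q ((Fintype.equivFin V).symm i), fun G => ?_⟩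
  rw [Equiv.sum_comp (Fintype.equivFin V).symm (fun v => G (Q v)), Fintype.sum_prod_type,
    Fintype.sum_sigma, Fintype.sum_prod_type]
  refine Finset.sum_congr rfl fun t _ => Finset.sum_congr rfl fun u _ => ?_
  simp only [Q, Finset.sum_const, card_univ, Fintype.card_fin, nsmul_eq_mul]
  rw [← Finset.sum_coe_sort H]

/-- Number of voters, counted by the weights `c`, ranking `w` first. -/
def topCount {m : ℕ} (c : Fin m → Fin m → ℕ) (w : Fin m) : ℕ := ∑ u, c w u

/-- Number of voters, counted by the weights `c`, ranking `w` last. -/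
def bottomCount {m : ℕ} (c : Fin m → Fin m → ℕ) (w : Fin m) : ℕ := ∑ t, c t w

/-- Score of `w` relative to that of an alternative always in the middle, if the top, middle and
bottom positions have scores `1`, `σ` and `0`. -/
noncomputable def relScore {m : ℕ} (c : Fin m → Fin m → ℕ) (σ : ℝ) (w : Fin m) : ℝ :=
  (1 - σ) * topCount c w - σ * bottomCount c w

lemma sum_top {m : ℕ} (c : Fin m → Fin m → ℕ) (x : Fin m) :
    ∑ t, ∑ u, (c t u : ℝ) * (if x = t then 1 else 0) = topCount c x := by
  rw [Finset.sum_comm]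
  simp [topCount]

lemma sum_bottom {m : ℕ} (c : Fin m → Fin m → ℕ) (x : Fin m) :
    ∑ t, ∑ u, (c t u : ℝ) * (if x = u then 1 else 0) = bottomCount c x := by
  simp [bottomCount]

lemma sum_top_bottom {m : ℕ} (c : Fin m → Fin m → ℕ) (x y : Fin m) :
    ∑ t, ∑ u, (c t u : ℝ) * (if x = t then if y = u then 1 else 0 else 0) = c x y := by
  rw [Finset.sum_eq_single x, Finset.sum_eq_single y] <;> simp +contextual [eq_comm]

/-- If weights `c t u` on (top, bottom) pairs separate the two scoring rules with the middle
positions blurred, then a profile separates the rules themselves. -/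
lemma exists_profile_of_weights {m : ℕ} (hm : 4 ≤ m) {s s' : Fin m → ℝ}
    (hs : IsScoreVec s) (hs' : IsScoreVec s') (c : Fin m → Fin m → ℕ) (hc : ∀ t, c t t = 0)
    (x : Fin m)
    (hcond : ∀ w, w ≠ x → topCount c x + bottomCount c w + c w x <
      topCount c w + bottomCount c x + c x w)
    (hwin : ∀ w, w ≠ x → relScore c (midScore s) w < relScore c (midScore s) x)
    (hlose : ∃ w, relScore c (midScore s') x < relScore c (midScore s') w) :
    ∃ n : ℕ, 0 < n ∧ ∃ P : Profile m n,
      CondorcetLoser P x ∧ winners s P = {x} ∧ x ∉ winners s' P := by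
  let z : Fin m := ⟨0, by omega⟩
  let l : Fin m := ⟨m - 1, by omega⟩
  have hz : (z : ℕ) = 0 := rfl
  have hl : (l : ℕ) = m - 1 := rfl
  have hzl : z ≠ l := by rw [ne_eq, Fin.ext_iff]; omega
  have he : ∀ t u : Fin m, ∃ e : Fin m ≃ Fin m, t ≠ u → e t = z ∧ e u = l := by
    intro t u
    by_cases h : t = u
    · exact ⟨Equiv.refl _, fun h' => absurd h h'⟩
    · obtain ⟨e, h'⟩ := exists_equiv_top_bottom hzl h
      exact ⟨e, fun _ => h'⟩
  choose e he using he
  have hez : ∀ t u y, t ≠ u → (e t u y = z ↔ y = t) := fun t u y h => by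
    rw [← (he t u h).1, (e t u).injective.eq_iff]
  have hel : ∀ t u y, t ≠ u → (e t u y = l ↔ y = u) := fun t u y h => by
    rw [← (he t u h).2, (e t u).injective.eq_iff]
  obtain ⟨n, P, hP⟩ := exists_profile_sum c e (fixingPerms z l)
  set N : ℝ := ((fixingPerms z l).card : ℝ) with hN
  have hNpos : 0 < N := by
    rw [hN]; exact_mod_cast fixingPerms_card_pos z l
  have hscore : ∀ {r : Fin m → ℝ}, IsScoreVec r → ∀ y, score r P y =
      N * (midScore r * ∑ t, ∑ u, (c t u : ℝ) + relScore c (midScore r) y) := by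
    intro r hr y
    rw [score, hP (fun g => r (g y)), relScore, ← sum_top, ← sum_bottom]
    simp only [Finset.mul_sum, ← Finset.sum_add_distrib, ← Finset.sum_sub_distrib]
    refine Finset.sum_congr rfl fun t _ => Finset.sum_congr rfl fun u _ => ?_
    by_cases htu : t = u
    · simp [htu, hc]
    simp only [Equiv.trans_apply]
    rw [← Finset.mul_sum, sum_fixingPerms_score hm hr hz hl]
    simp only [hez t u y htu, hel t u y htu]
    ring
  have hmargin : ∀ y, y ≠ x →
      ((univ.filter fun i => P i y ≤ P i x).card : ℝ) -
        (univ.filter fun i => P i x ≤ P i y).card =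
      N * (topCount c y + bottomCount c x + c x y - topCount c x - bottomCount c y - c y x) := by
    intro y hy
    have h := hP (fun g => rankSign (g x) (g y))
    have hcard : ((univ.filter fun i => P i y ≤ P i x).card : ℝ) -
        (univ.filter fun i => P i x ≤ P i y).card = ∑ i, rankSign (P i x) (P i y) := by
      simp only [rankSign, Finset.sum_sub_distrib, Finset.sum_boole]
    rw [hcard, h, ← sum_top c x, ← sum_top c y, ← sum_bottom c x, ← sum_bottom c y,
      ← sum_top_bottom c x y, ← sum_top_bottom c y x]
    simp only [← Finset.sum_add_distrib, ← Finset.sum_sub_distrib]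
    simp only [Finset.mul_sum _ _ N]
    refine Finset.sum_congr rfl fun t _ => Finset.sum_congr rfl fun u _ => ?_
    by_cases htu : t = u
    · simp [htu, hc]
    have h' := sum_fixingPerms_rankSign hm hz hl
      (fun h => hy ((e t u).injective h).symm : e t u x ≠ e t u y)
    simp only [hez t u _ htu, hel t u _ htu] at h'
    simp only [Equiv.trans_apply]
    rw [h']
    ring
  have hCL : CondorcetLoser P x := by
    intro y hy
    have h1 := hmargin y hy
    have h2 : (topCount c x + bottomCount c y + c y x : ℝ) <
      topCount c y + bottomCount c x + c x y := by exact_mod_cast hcond y hy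
    have h3 := mul_pos hNpos (sub_pos.2 h2)
    have : ((univ.filter fun i => P i x ≤ P i y).card : ℝ) <
      (univ.filter fun i => P i y ≤ P i x).card := by linarith
    exact_mod_cast this
  have hlt : ∀ y, y ≠ x → score s P y < score s P x := by
    intro y hy
    rw [hscore hs, hscore hs]
    have := hwin y hy
    gcongr
  refine ⟨n, ?_, P, hCL, ?_, ?_⟩
  · rcases Nat.eq_zero_or_pos n with h | h
    · subst h
      obtain ⟨y, hy⟩ : ∃ y, y ≠ x :=
        haveI : Nontrivial (Fin m) := ⟨z, l, hzl⟩
        exists_ne x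
      simpa using hCL y hy
    · exact h
  · ext y
    simp only [winners, Set.mem_ofPred_eq, Set.mem_singleton_iff]
    constructor
    · intro h
      by_contra hy
      exact absurd (h x) (hlt y hy).not_ge
    · rintro rfl w
      by_cases hw : w = y
      · rw [hw]
      · exact (hlt w hw).le
  · obtain ⟨w, hw⟩ := hlose
    intro h
    have h1 : score s' P w ≤ score s' P x := h w
    rw [hscore hs', hscore hs'] at h1
    have := le_of_mul_le_mul_left h1 hNpos
    linarith

/-- One voter for each ordered pair of distinct elements of `S`. -/
def pairWeight {m : ℕ} (S : Finset (Fin m)) (t u : Fin m) : ℕ :=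
  if t ∈ S ∧ u ∈ S ∧ t ≠ u then 1 else 0

lemma pairWeight_comm {m : ℕ} (S : Finset (Fin m)) (t u : Fin m) :
    pairWeight S t u = pairWeight S u t := by
  simp only [pairWeight]
  congr 1
  exact propext ⟨fun h => ⟨h.2.1, h.1, h.2.2.symm⟩, fun h => ⟨h.2.1, h.1, h.2.2.symm⟩⟩

lemma pairWeight_self {m : ℕ} (S : Finset (Fin m)) (t : Fin m) : pairWeight S t t = 0 := by
  simp [pairWeight]

lemma sum_pairWeight_right {m : ℕ} (S : Finset (Fin m)) (t : Fin m) :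
    ∑ u, pairWeight S t u = if t ∈ S then S.card - 1 else 0 := by
  by_cases ht : t ∈ S
  · simp only [pairWeight, ht, true_and, if_true]
    rw [← Finset.card_erase_of_mem ht, ← Finset.card_filter]
    congr 1
    ext u
    simp [and_comm, eq_comm]
  · simp [pairWeight, ht]

lemma sum_pairWeight_left {m : ℕ} (S : Finset (Fin m)) (u : Fin m) :
    ∑ t, pairWeight S t u = if u ∈ S then S.card - 1 else 0 := by
  simp only [pairWeight_comm S _ u, sum_pairWeight_right]

lemma midScore_le_one {m : ℕ} (hm : 4 ≤ m) {s : Fin m → ℝ} (hs : IsScoreVec s) :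
    midScore s ≤ 1 := by
  have h := sum_fixingPerms_score hm hs (z := ⟨0, by omega⟩) (l := ⟨m - 1, by omega⟩) rfl rfl
    ⟨1, by omega⟩
  have h2 : ∑ g ∈ fixingPerms (⟨0, by omega⟩ : Fin m) ⟨m - 1, by omega⟩, s (g ⟨1, by omega⟩) ≤
      (fixingPerms (⟨0, by omega⟩ : Fin m) ⟨m - 1, by omega⟩).card * (1 : ℝ) := by
    rw [← nsmul_eq_mul]
    exact Finset.sum_le_card_nsmul _ _ _ fun g _ => (hs.2.1 _).2
  have hne : ¬ 1 = m - 1 := by omega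
  rw [h] at h2
  have := le_of_mul_le_mul_left h2 (by exact_mod_cast fixingPerms_card_pos _ _)
  simpa [hne] using this

lemma exists_nat_ratio_between {a b : ℝ} (ha : 0 ≤ a) (hab : a < b) :
    ∃ p q : ℕ, 0 < q ∧ a * q < p ∧ (p : ℝ) < b * q := by
  obtain ⟨r, h1, h2⟩ := exists_rat_btwn hab
  have hr : 0 < r := by exact_mod_cast ha.trans_lt h1
  have hq : (0 : ℝ) < r.den := by exact_mod_cast r.den_pos
  have hcast : (r : ℝ) = (r.num.toNat : ℝ) / r.den := by
    have : ((r.num.toNat : ℤ) : ℝ) = r.num := by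
      rw [Int.toNat_of_nonneg (Rat.num_pos.2 hr).le]
    rw [← Int.cast_natCast, this]
    exact Rat.cast_def r
  rw [hcast] at h1 h2
  exact ⟨r.num.toNat, r.den, r.den_pos, (lt_div_iff₀ hq).1 h1, (div_lt_iff₀ hq).1 h2⟩

/-- Separating profile when the middle score of `s` exceeds both `1 / 2` and that of `s'`. -/
lemma exists_profile_of_midScore_gt {m : ℕ} (hm : 4 ≤ m) {s s' : Fin m → ℝ}
    (hs : IsScoreVec s) (hs' : IsScoreVec s') (hhalf : 1 / 2 < midScore s)
    (hlt : midScore s' < midScore s) (x : Fin m) :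
    ∃ n : ℕ, 0 < n ∧ ∃ P : Profile m n,
      CondorcetLoser P x ∧ winners s P = {x} ∧ x ∉ winners s' P := by
  obtain ⟨a, b, hb, h1, h2⟩ := exists_nat_ratio_between (a := max (1 / 2) (midScore s'))
    (le_max_of_le_left (by norm_num)) (max_lt hhalf hlt)
  have hb' : (0 : ℝ) < b := by exact_mod_cast hb
  have h3 : (b : ℝ) < 2 * a := by
    have := mul_le_mul_of_nonneg_right (le_max_left (1 / 2) (midScore s')) hb'.le
    linarith
  have h4 : midScore s' * b < a :=
    (mul_le_mul_of_nonneg_right (le_max_right (1 / 2) (midScore s')) hb'.le).trans_lt h1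
  obtain ⟨k, rfl⟩ : ∃ k, m = k + 4 := ⟨m - 4, by omega⟩
  obtain ⟨d, hd, hd0⟩ : ∃ d : ℕ, 2 * a = b + d ∧ 0 < d := by
    have : b < 2 * a := by exact_mod_cast h3
    exact ⟨2 * a - b, by omega, by omega⟩
  have hdR : (2 * a : ℝ) = b + d := by exact_mod_cast hd
  let S : Finset (Fin (k + 4)) := univ.erase x
  have hS : S.card - 1 = k + 2 := by simp [S]
  have hmem : ∀ w, w ∈ S ↔ w ≠ x := by simp [S]
  let N := b + a * (k + 2)
  let e := (k + 2) * d
  let c : Fin (k + 4) → Fin (k + 4) → ℕ := fun t u =>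
    N * pairWeight S t u + if t ∈ S then if u = x then e else 0 else 0
  have hx : x ∉ S := by simp [S]
  have htop : ∀ w, w ≠ x → topCount c w = N * (k + 2) + e := by
    intro w hw
    simp [topCount, c, Finset.sum_add_distrib, ← Finset.mul_sum, sum_pairWeight_right, hS,
      (hmem w).2 hw]
  have hbot : ∀ w, w ≠ x → bottomCount c w = N * (k + 2) := by
    intro w hw
    simp [bottomCount, c, ← Finset.mul_sum, sum_pairWeight_left, hS, (hmem w).2 hw, hw]
  have htopx : topCount c x = 0 := by
    simp [topCount, c, pairWeight, hx]
  have hbotx : bottomCount c x = (k + 3) * e := by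
    simp only [bottomCount, c, Finset.sum_add_distrib, ← Finset.mul_sum, sum_pairWeight_left, hx]
    simp only [if_true, if_false, Finset.sum_ite_mem, univ_inter, Finset.sum_const]
    simp [S]
  have hrel : ∀ σ w, w ≠ x → relScore c σ x - relScore c σ w =
      (k + 2) * (k + 4) * (b * σ - a) := by
    intro σ w hw
    simp only [relScore, htop w hw, hbot w hw, htopx, hbotx, N, e]
    push_cast
    have : (d : ℝ) = 2 * a - b := by linarith
    rw [this]
    ring
  have hpos : (0 : ℝ) < (k + 2) * (k + 4) := by positivity
  refine exists_profile_of_weights hm hs hs' c ?_ x ?_ ?_ ?_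
  · intro t
    by_cases ht : t = x <;> simp [c, pairWeight_self, ht, hx]
  · intro w hw
    have hcw : c w x = e := by simp [c, (hmem w).2 hw, pairWeight, hx]
    have hcx : c x w = 0 := by simp [c, pairWeight, hx]
    have he : 0 < e := by positivity
    rw [htop w hw, hbot w hw, htopx, hbotx, hcw, hcx]
    nlinarith
  · intro w hw
    have := mul_pos hpos (show 0 < b * midScore s - a by linarith)
    linarith [hrel (midScore s) w hw]
  · obtain ⟨w, hw⟩ := exists_ne x
    have := mul_pos hpos (show 0 < a - b * midScore s' by linarith)
    exact ⟨w, by linarith [hrel (midScore s') w hw]⟩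

/-- Separating profile when the middle score of `s` lies between `1 / 2` and that of `s'`. -/
lemma exists_profile_of_midScore_lt {m : ℕ} (hm : 4 ≤ m) {s s' : Fin m → ℝ}
    (hs : IsScoreVec s) (hs' : IsScoreVec s') (hhalf : 1 / 2 < midScore s)
    (hlt : midScore s < midScore s') {x y z : Fin m} (hxy : x ≠ y) (hxz : x ≠ z) (hyz : y ≠ z) :
    ∃ n : ℕ, 0 < n ∧ ∃ P : Profile m n,
      CondorcetLoser P x ∧ winners s P = {x} ∧ x ∉ winners s' P := by
  obtain ⟨p, d, hd, h1, h2⟩ := exists_nat_ratio_between (a := midScore s) (b := midScore s')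
    (by linarith) hlt
  have hd' : (0 : ℝ) < d := by exact_mod_cast hd
  have hpd : p < d := by
    have := mul_le_mul_of_nonneg_right (midScore_le_one hm hs') hd'.le
    have : (p : ℝ) < d := by linarith
    exact_mod_cast this
  obtain ⟨q, rfl⟩ : ∃ q, d = p + q := ⟨d - p, by omega⟩
  have hq : 0 < q := by omega
  obtain ⟨K, hK⟩ := exists_nat_gt (10 * (p + q : ℝ) / (2 * midScore s - 1))
  rw [div_lt_iff₀ (by linarith)] at hK
  let S : Finset (Fin m) := (univ.erase x).erase y
  obtain ⟨α, hα, hα1⟩ : ∃ α : ℕ, S.card - 1 = α ∧ 1 ≤ α := by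
    have : S.card = m - 1 - 1 := by simp [S, card_erase_of_mem, hxy.symm]
    exact ⟨_, rfl, by omega⟩
  have hx : x ∉ S := by simp [S]
  have hy : y ∉ S := by simp [S]
  have hmem : ∀ w, w ≠ x → w ≠ y → w ∈ S := fun w h h' => by simp [S, h, h']
  let c : Fin m → Fin m → ℕ := fun t u =>
    K * pairWeight S t u + (if t = x then if u = y then p else 0 else 0) +
      (if t = z then if u = y then q else 0 else 0) +
      (if t = z then if u = x then 2 * q + p else 0 else 0)
  have htop : ∀ w, topCount c w = K * (if w ∈ S then α else 0) + (if w = x then p else 0) +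
      (if w = z then 3 * q + p else 0) := by
    intro w
    by_cases h1 : w = x <;> by_cases h2 : w = z <;>
    simp [topCount, c, Finset.sum_add_distrib, ← Finset.mul_sum, sum_pairWeight_right, hα, h1, h2,
      hxz, hxz.symm]
    ring
  have hbot : ∀ w, bottomCount c w = K * (if w ∈ S then α else 0) +
      (if w = y then p + q else 0) + (if w = x then 2 * q + p else 0) := by
    intro w
    by_cases h1 : w = x <;> by_cases h2 : w = y <;>
    simp [bottomCount, c, Finset.sum_add_distrib, ← Finset.mul_sum, sum_pairWeight_left, hα,
      h1, h2, hxy, hxy.symm]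
    ring
  have hrelx : ∀ σ, relScore c σ x = p - 2 * σ * (p + q) := by
    intro σ
    simp [relScore, htop, hbot, hx, hxy, hxz]
    ring
  have hrely : ∀ σ, relScore c σ y = - σ * (p + q) := by
    intro σ
    simp [relScore, htop, hbot, hy, hxy.symm, hyz]
  push_cast at h1 h2
  refine exists_profile_of_weights hm hs hs' c ?_ x ?_ ?_ ⟨y, ?_⟩
  · intro t
    by_cases h1 : t = x
    · simp [c, pairWeight_self, h1, hxy, hxz]
    · by_cases h2 : t = y <;> simp [c, pairWeight_self, h1, h2, hxy.symm, hyz]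
  · intro w hw
    have hcx : c x w = if w = y then p else 0 := by simp [c, pairWeight, hx, hxz]
    have hcw : c w x = if w = z then 2 * q + p else 0 := by simp [c, pairWeight, hx, hxy]
    rw [hcx, hcw]
    simp only [htop, hbot, hx, hw, hxy, hxz, if_true, if_false]
    by_cases hwy : w = y
    · simp only [hwy, hy, hyz, if_true, if_false]
      omega
    · by_cases hwz : w = z <;> simp only [hwy, hwz, hyz.symm, if_true, if_false] <;> omega
  · intro w hw
    by_cases hwy : w = y
    · subst hwy
      rw [hrelx, hrely]
      linarith
    · have hσ := midScore_le_one hm hs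
      have hpq : (0 : ℝ) ≤ p ∧ (0 : ℝ) < q := ⟨by positivity, by exact_mod_cast hq⟩
      have hKα : K * (2 * midScore s - 1) ≤ (K * α : ℝ) * (2 * midScore s - 1) := by
        have : (1 : ℝ) ≤ α := by exact_mod_cast hα1
        have h0 : (0 : ℝ) ≤ K := by positivity
        exact mul_le_mul_of_nonneg_right (by nlinarith) (by linarith)
      have hw' : relScore c (midScore s) w ≤
          - ((K * α : ℝ) * (2 * midScore s - 1)) + (3 * q + p) := by
        simp only [relScore, htop, hbot, hmem w hw hwy, hwy, hw, if_true, if_false]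
        by_cases hwz : w = z <;> simp only [hwz, if_true, if_false] <;> push_cast <;> nlinarith
      rw [hrelx]
      nlinarith
  · rw [hrelx, hrely]
    linarith

/-- Number of voters with top alternative `t` and bottom alternative `u`. -/
def pairCount {k n : ℕ} (f g : Fin n → Fin k) (t u : Fin k) : ℕ :=
  (univ.filter fun i => f i = t ∧ g i = u).card

lemma topCount_pairCount {k n : ℕ} (f g : Fin n → Fin k) (w : Fin k) :
    topCount (pairCount f g) w = (univ.filter fun i => f i = w).card := by
  rw [Finset.card_eq_sum_card_fiberwise (f := g) (t := univ) (by simp)]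
  simp [topCount, pairCount, Finset.filter_filter]

lemma bottomCount_pairCount {k n : ℕ} (f g : Fin n → Fin k) (w : Fin k) :
    bottomCount (pairCount f g) w = (univ.filter fun i => g i = w).card := by
  rw [Finset.card_eq_sum_card_fiberwise (f := f) (t := univ) (by simp)]
  simp [bottomCount, pairCount, Finset.filter_filter, and_comm]

lemma sum_topCount_pairCount {k n : ℕ} (f g : Fin n → Fin k) :
    ∑ w, topCount (pairCount f g) w = n := by
  simp only [topCount_pairCount]
  rw [← Finset.card_eq_sum_card_fiberwise (f := f) (by simp)]
  simp

lemma sum_bottomCount_pairCount {k n : ℕ} (f g : Fin n → Fin k) :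
    ∑ w, bottomCount (pairCount f g) w = n := by
  simp only [bottomCount_pairCount]
  rw [← Finset.card_eq_sum_card_fiberwise (f := g) (by simp)]
  simp

/-- (Top, bottom) counts of a profile on three alternatives. -/
def tripleCount {n : ℕ} (P : Profile 3 n) : Fin 3 → Fin 3 → ℕ :=
  pairCount (fun i => (P i).symm 0) (fun i => (P i).symm 2)

lemma score_sAve {m n : ℕ} (r : Fin m → ℝ) (P : Profile 3 n) (j : Fin 3) :
    score (sAve r) P j = midScore r * n + relScore (tripleCount P) (midScore r) j := by
  have hv : ∀ a : Fin 3, sAve r a = midScore r + (1 - midScore r) * (if 0 = a then 1 else 0) -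
      midScore r * (if 2 = a then 1 else 0) := by
    intro a
    fin_cases a <;> simp [sAve, midScore]
  simp only [score, hv, Finset.sum_add_distrib, Finset.sum_sub_distrib, ← Finset.mul_sum,
    Finset.sum_boole, relScore, tripleCount, topCount_pairCount, bottomCount_pairCount,
    Equiv.symm_apply_eq, Finset.sum_const, card_univ, Fintype.card_fin, nsmul_eq_mul]
  ring

lemma card_le_add_tripleCount {n : ℕ} (P : Profile 3 n) {x y : Fin 3} (hxy : x ≠ y) :
    (univ.filter fun i => P i x ≤ P i y).card + tripleCount P x y =
      topCount (tripleCount P) x + bottomCount (tripleCount P) y := by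
  have key : ∀ a b : Fin 3, a ≠ b → (if a ≤ b then 1 else 0) + (if 0 = a ∧ 2 = b then 1 else 0) =
      (if 0 = a then 1 else 0) + (if 2 = b then 1 else 0) := by decide
  rw [tripleCount, topCount_pairCount, bottomCount_pairCount, pairCount]
  simp only [Equiv.symm_apply_eq, Finset.card_filter, ← Finset.sum_add_distrib]
  exact Finset.sum_congr rfl fun i _ => key _ _ ((P i).injective.ne hxy)

/-- Separating profile when the middle score of `s` is at most `1 / 2`. -/
lemma exists_profile_of_midScore_le_half {m : ℕ} (hm : 4 ≤ m) {s s' : Fin m → ℝ}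
    (hs : IsScoreVec s) (hs' : IsScoreVec s') (hhalf : midScore s ≤ 1 / 2)
    {n : ℕ} (P : Profile 3 n) (hCL : CondorcetLoser P 0)
    (hwin : ∀ j, j ≠ 0 → score (sAve s) P j < score (sAve s) P 0)
    (hlose : ∃ j, score (sAve s') P 0 < score (sAve s') P j) :
    ∃ n : ℕ, 0 < n ∧ ∃ Q : Profile m n, CondorcetLoser Q ⟨0, by omega⟩ ∧
      winners s Q = {(⟨0, by omega⟩ : Fin m)} ∧ (⟨0, by omega⟩ : Fin m) ∉ winners s' Q := by
  let ι : Fin 3 → Fin m := Fin.castLE (by omega)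
  have hι : Function.Injective ι := Fin.castLE_injective _
  let c := pairCount (fun i => ι ((P i).symm 0)) (fun i => ι ((P i).symm 2))
  have hc : ∀ j k, c (ι j) (ι k) = tripleCount P j k := fun j k => by
    simp [c, pairCount, tripleCount, hι.eq_iff]
  have htop : ∀ j, topCount c (ι j) = topCount (tripleCount P) j := fun j => by
    simp [c, tripleCount, topCount_pairCount, hι.eq_iff]
  have hbot : ∀ j, bottomCount c (ι j) = bottomCount (tripleCount P) j := fun j => by
    simp [c, tripleCount, bottomCount_pairCount, hι.eq_iff]
  have hrel : ∀ σ j, relScore c σ (ι j) = relScore (tripleCount P) σ j := fun σ j => by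
    simp only [relScore, htop, hbot]
  have htop0 : ∀ w, (∀ j, ι j ≠ w) → topCount c w = 0 := fun w hw => by
    simp [c, topCount_pairCount, hw]
  have hbot0 : ∀ w, (∀ j, ι j ≠ w) → bottomCount c w = 0 := fun w hw => by
    simp [c, bottomCount_pairCount, hw]
  have hself : ∀ j, tripleCount P j j = 0 := fun j => by
    simp only [tripleCount, pairCount, Equiv.symm_apply_eq, Finset.card_eq_zero,
      Finset.filter_eq_empty_iff]
    exact fun i _ h => absurd (h.1.trans h.2.symm) (by decide)
  simp only [score_sAve, add_lt_add_iff_left] at hwin hlose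
  have hmaj : ∀ y : Fin 3, y ≠ 0 →
      topCount (tripleCount P) 0 + bottomCount (tripleCount P) y + tripleCount P y 0 <
        topCount (tripleCount P) y + bottomCount (tripleCount P) 0 + tripleCount P 0 y := by
    intro y hy
    have h1 := hCL y hy
    have h2 := card_le_add_tripleCount P hy
    have h3 := card_le_add_tripleCount P hy.symm
    omega
  have hF := sum_topCount_pairCount (fun i => (P i).symm 0) (fun i => (P i).symm 2)
  have hL := sum_bottomCount_pairCount (fun i => (P i).symm 0) (fun i => (P i).symm 2)
  rw [← tripleCount, Fin.sum_univ_three] at hF hL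
  have hF0 : topCount (tripleCount P) 0 = tripleCount P 0 1 + tripleCount P 0 2 := by
    rw [topCount, Fin.sum_univ_three, hself, zero_add]
  have hL0 : bottomCount (tripleCount P) 0 = tripleCount P 1 0 + tripleCount P 2 0 := by
    rw [bottomCount, Fin.sum_univ_three, hself, zero_add]
  have hFL : topCount (tripleCount P) 0 < bottomCount (tripleCount P) 0 := by
    have h1 := hmaj 1 (by decide)
    have h2 := hmaj 2 (by decide)
    omega
  have hrel0 : 0 < relScore (tripleCount P) (midScore s) 0 := by
    have h1 := hwin 1 (by decide)
    have h2 := hwin 2 (by decide)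
    have hsum : relScore (tripleCount P) (midScore s) 0 + relScore (tripleCount P) (midScore s) 1
        + relScore (tripleCount P) (midScore s) 2 = (1 - 2 * midScore s) * n := by
      have hF' : (topCount (tripleCount P) 0 + topCount (tripleCount P) 1
        + topCount (tripleCount P) 2 : ℝ) = n := by exact_mod_cast hF
      have hL' : (bottomCount (tripleCount P) 0 + bottomCount (tripleCount P) 1
        + bottomCount (tripleCount P) 2 : ℝ) = n := by exact_mod_cast hL
      simp only [relScore]
      linear_combination (1 - midScore s) * hF' - midScore s * hL'
    have : 0 ≤ (1 - 2 * midScore s) * n := mul_nonneg (by linarith) (by positivity)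
    linarith
  have h0 : (⟨0, by omega⟩ : Fin m) = ι 0 := rfl
  rw [h0]
  refine exists_profile_of_weights hm hs hs' c ?_ _ ?_ ?_ ?_
  · intro t
    by_cases ht : ∃ j, ι j = t
    · obtain ⟨j, rfl⟩ := ht
      rw [hc, hself]
    · push Not at ht
      simp [c, pairCount, ht]
  · intro w hw
    by_cases ht : ∃ j, ι j = w
    · obtain ⟨j, rfl⟩ := ht
      rw [htop, htop, hbot, hbot, hc, hc]
      exact hmaj j fun h => hw (by rw [h])
    · push Not at ht
      have h1 : c w (ι 0) = 0 := by simp [c, pairCount, ht]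
      rw [htop, hbot, htop0 w ht, hbot0 w ht, h1]
      omega
  · intro w hw
    by_cases ht : ∃ j, ι j = w
    · obtain ⟨j, rfl⟩ := ht
      rw [hrel, hrel]
      exact hwin j fun h => hw (by rw [h])
    · push Not at ht
      rw [hrel, relScore, htop0 w ht, hbot0 w ht]
      simpa using hrel0
  · obtain ⟨j, hj⟩ := hlose
    exact ⟨ι j, by rwa [hrel, hrel]⟩

/-- Lifting a separating profile for `s_ave, s'_ave` on three alternatives to
one for `s, s'` on `m` alternatives. -/
theorem lift_sAve_profile
    (m : ℕ) (hm : 4 ≤ m) (s s' : Fin m → ℝ)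
    (hs : IsScoreVec s) (hs' : IsScoreVec s')
    (hprev : ∃ n : ℕ, 0 < n ∧ ∃ P : Profile 3 n,
      CondorcetLoser P 0 ∧
      winners (sAve s) P = {(0 : Fin 3)} ∧
      (0 : Fin 3) ∉ winners (sAve s') P) :
    ∃ n : ℕ, 0 < n ∧ ∃ P : Profile m n,
      CondorcetLoser P ⟨0, by omega⟩ ∧
      winners s P = {(⟨0, by omega⟩ : Fin m)} ∧
      (⟨0, by omega⟩ : Fin m) ∉ winners s' P := by
  obtain ⟨n, -, P, hCL, hwin, hlose⟩ := hprev
  have hwin' : ∀ j, j ≠ 0 → score (sAve s) P j < score (sAve s) P 0 := by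
    have h0 : (0 : Fin 3) ∈ winners (sAve s) P := by rw [hwin]; rfl
    intro j hj
    refine lt_of_le_of_ne (h0 j) fun h => hj ?_
    have hmem : j ∈ winners (sAve s) P := fun y => h ▸ h0 y
    rwa [hwin] at hmem
  have hlose' : ∃ j, score (sAve s') P 0 < score (sAve s') P j := by
    by_contra! h
    exact hlose h
  rcases le_or_gt (midScore s) (1 / 2) with hhalf | hhalf
  · exact exists_profile_of_midScore_le_half hm hs hs' hhalf P hCL hwin' hlose'
  rcases lt_trichotomy (midScore s) (midScore s') with hlt | heq | hlt
  · exact exists_profile_of_midScore_lt hm hs hs' hhalf hlt (y := ⟨1, by omega⟩)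
      (z := ⟨2, by omega⟩) (by simp) (by simp) (by simp)
  · obtain ⟨j, hj⟩ := hlose'
    rw [score_sAve, score_sAve, ← heq, ← score_sAve, ← score_sAve] at hj
    by_cases h : j = 0
    · exact absurd hj (by simp [h])
    · exact absurd hj (hwin' j h).not_gt
  · exact exists_profile_of_midScore_gt hm hs hs' hhalf hlt _
end
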